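/- Suppose H = Σ_{i=1}^r τ_i z_i z_i^T where {z_1, …, z_r} ⊆ {0,1}^n is a Schur independent family of binary vectors and τ_i > 0 sum to 1. If also H = Σ_{j=1}^{r'} τ'_j z'_j (z'_j)^T where the z'_j ∈ {0,1}^n are pairwise distinct and τ'_j > 0 sum to 1, then r' = r and there exists a permutation π of {1,…,r} such that z'_j = z_{π(j)} and τ'_j = τ_{π(j)} for every j. That is, the binary component decomposition of H is unique up to permutation of terms. -/

import Mathlib

open Matrix

noncomputable section

/-- Schur independence of a family of binary vectors: the all-ones vector, the vectors
`z i` themselves, and the entrywise products `z i ⊙ z j` for `i < j` form a linearly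
independent family. -/
def BinarySchurIndependent {n r : ℕ} (z : Fin r → Fin n → ℝ) : Prop :=
  LinearIndependent ℝ (fun p : Option (Fin r ⊕ {q : Fin r × Fin r // q.1 < q.2}) =>
    p.elim (fun _ : Fin n => (1 : ℝ))
      (Sum.elim (fun i => z i) (fun q k => z q.1.1 k * z q.1.2 k)))

theorem sq_sum_eq_sum_sq_add_sum_lt {r : ℕ} (a : Fin r → ℝ) :
    (∑ i, a i) ^ 2 =
      ∑ i, a i ^ 2 + ∑ q : {q : Fin r × Fin r // q.1 < q.2}, 2 * (a q.1.1 * a q.1.2) := by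
  have hsub : ∑ q : {q : Fin r × Fin r // q.1 < q.2}, 2 * (a q.1.1 * a q.1.2) =
      ∑ i, ∑ j, if i < j then 2 * (a i * a j) else 0 := by
    rw [← Fintype.sum_prod_type' (f := fun i j => if i < j then 2 * (a i * a j) else 0),
      ← Finset.sum_filter]
    exact (Finset.sum_subtype _ (by simp) (fun q : Fin r × Fin r => 2 * (a q.1 * a q.2))).symm
  have hdiag : ∑ i, a i ^ 2 = ∑ i, ∑ j, if i = j then a i * a j else 0 := by
    simp [sq]
  have hswap : ∑ i, ∑ j, (if i < j then a i * a j else 0) =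
      ∑ i, ∑ j, if j < i then a i * a j else 0 := by
    rw [Finset.sum_comm]
    simp only [mul_comm]
  have htwo : ∑ i, ∑ j, (if i < j then 2 * (a i * a j) else 0) =
      ∑ i, ∑ j, (if i < j then a i * a j else 0) +
        ∑ i, ∑ j, if j < i then a i * a j else 0 := by
    rw [← hswap, ← two_mul]
    simp only [Finset.mul_sum, mul_ite, mul_zero]
  rw [hsub, hdiag, htwo, sq, Finset.sum_mul_sum]
  simp only [← Finset.sum_add_distrib]
  refine Finset.sum_congr rfl fun i _ => Finset.sum_congr rfl fun j _ => ?_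
  rcases lt_trichotomy i j with h | h | h
  · simp [h, h.ne, h.not_gt]
  · simp [h]
  · simp [h, h.ne', h.not_gt]

theorem BinarySchurIndependent.linearIndependent {n r : ℕ} {z : Fin r → Fin n → ℝ}
    (h : BinarySchurIndependent z) : LinearIndependent ℝ z :=
  h.comp (fun i => some (Sum.inl i)) fun _ _ hij => Sum.inl_injective (Option.some_injective _ hij)

/-- A binary vector in the span of a Schur independent family of binary vectors is zero or
belongs to the family. -/
theorem BinarySchurIndependent.eq_zero_or_exists_eq {n r : ℕ} {z : Fin r → Fin n → ℝ}
    (h : BinarySchurIndependent z) (hz : ∀ i k, z i k = 0 ∨ z i k = 1)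
    {x : Fin n → ℝ} (hx : ∀ k, x k = 0 ∨ x k = 1)
    (hmem : x ∈ Submodule.span ℝ (Set.range z)) : x = 0 ∨ ∃ i, x = z i := by
  obtain ⟨c, rfl⟩ := (Submodule.mem_span_range_iff_exists_fun ℝ).1 hmem
  have hcoeff := Fintype.linearIndependent_iff.1 h
    (fun p => p.elim 0 (Sum.elim (fun i => c i ^ 2 - c i) fun q => 2 * (c q.1.1 * c q.1.2))) (by
      ext k
      have hsq : (∑ i, c i * z i k) ^ 2 = ∑ i, c i * z i k := by
        have := hx k
        simp only [Finset.sum_apply, Pi.smul_apply, smul_eq_mul] at this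
        rcases this with h0 | h1
        · simp [h0]
        · simp [h1]
      rw [sq_sum_eq_sum_sq_add_sum_lt] at hsq
      have hzsq : ∀ i, (c i * z i k) ^ 2 = c i ^ 2 * z i k := fun i => by
        rcases hz i k with h0 | h1
        · simp [h0]
        · simp [h1]
      have hprod : ∀ i j, 2 * (c i * z i k * (c j * z j k)) =
          2 * (c i * c j) * (z i k * z j k) := fun i j => by ring
      simp only [hzsq, hprod] at hsq
      simp only [Fintype.sum_option, Fintype.sum_sum_type, Option.elim_none, Option.elim_some,
        Sum.elim_inl, Sum.elim_inr, Finset.sum_apply, Pi.smul_apply, smul_eq_mul,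
        Pi.zero_apply, zero_mul, sub_mul, Finset.sum_sub_distrib]
      linarith)
  have hidem : ∀ i, c i = 0 ∨ c i = 1 := fun i => by
    have hi : c i ^ 2 - c i = 0 := hcoeff (some (Sum.inl i))
    have : c i * (c i - 1) = 0 := by linarith
    rcases mul_eq_zero.1 this with h0 | h1
    · exact Or.inl h0
    · exact Or.inr (sub_eq_zero.1 h1)
  have horth : ∀ i j, i ≠ j → c i * c j = 0 := by
    have hlt : ∀ i j, i < j → c i * c j = 0 := fun i j hij => by
      have : 2 * (c i * c j) = 0 := hcoeff (some (Sum.inr ⟨(i, j), hij⟩))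
      linarith
    intro i j hij
    rcases hij.lt_or_gt with h | h
    · exact hlt i j h
    · rw [mul_comm, hlt j i h]
  by_cases hc : ∀ i, c i = 0
  · left
    simp [hc]
  · push Not at hc
    obtain ⟨i, hi⟩ := hc
    right
    refine ⟨i, ?_⟩
    rw [Finset.sum_eq_single i, (hidem i).resolve_left hi, one_smul]
    · intro j _ hj
      rw [(mul_eq_zero.1 (horth i j hj.symm)).resolve_left hi, zero_smul]
    · simp

theorem dotProduct_sum_smul_vecMulVec_mulVec {ι m : Type*} [Fintype ι] [Fintype m]
    (τ : ι → ℝ) (z : ι → m → ℝ) (w : m → ℝ) :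
    w ⬝ᵥ ((∑ i, τ i • vecMulVec (z i) (z i)) *ᵥ w) = ∑ i, τ i * (z i ⬝ᵥ w) ^ 2 := by
  rw [Matrix.sum_mulVec, dotProduct_sum]
  refine Finset.sum_congr rfl fun i _ => ?_
  rw [Matrix.smul_mulVec, vecMulVec_mulVec, dotProduct_smul, op_smul_eq_smul, dotProduct_smul,
    dotProduct_comm w, smul_eq_mul, smul_eq_mul, sq]

/-- Equal rank-one decompositions give equal quadratic forms on the dual space. -/
theorem sum_mul_sq_eq_of_sum_smul_vecMulVec_eq {ι κ m : Type*} [Fintype ι] [Fintype κ]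
    [Fintype m] {τ : ι → ℝ} {z : ι → m → ℝ} {τ' : κ → ℝ} {z' : κ → m → ℝ}
    (heq : ∑ i, τ i • vecMulVec (z i) (z i) = ∑ j, τ' j • vecMulVec (z' j) (z' j))
    (f : (m → ℝ) →ₗ[ℝ] ℝ) : ∑ i, τ i * f (z i) ^ 2 = ∑ j, τ' j * f (z' j) ^ 2 := by
  classical
  have hf : ∀ v, f v = v ⬝ᵥ fun k => f (Pi.single k 1) := fun v => by
    rw [f.pi_apply_eq_sum_univ v]
    refine Finset.sum_congr rfl fun k _ => ?_
    rw [smul_eq_mul]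
    congr 2
    ext l
    simp [Pi.single_apply, eq_comm]
  simp only [hf (z _), hf (z' _), ← dotProduct_sum_smul_vecMulVec_mulVec, heq]

theorem mem_span_range_of_sum_smul_vecMulVec_eq {ι κ m : Type*} [Fintype ι] [Fintype κ]
    [Fintype m] {τ : ι → ℝ} {z : ι → m → ℝ} {τ' : κ → ℝ} {z' : κ → m → ℝ}
    (hτ' : ∀ j, 0 < τ' j)
    (heq : ∑ i, τ i • vecMulVec (z i) (z i) = ∑ j, τ' j • vecMulVec (z' j) (z' j)) (j : κ) :
    z' j ∈ Submodule.span ℝ (Set.range z) := by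
  by_contra hj
  obtain ⟨f, hfj, hf⟩ := Submodule.exists_le_ker_of_notMem hj
  have hfz : ∀ i, f (z i) = 0 := fun i => hf (Submodule.subset_span ⟨i, rfl⟩)
  have hsum := sum_mul_sq_eq_of_sum_smul_vecMulVec_eq heq f
  simp only [hfz, ne_eq, OfNat.ofNat_ne_zero, not_false_eq_true, zero_pow, mul_zero,
    Finset.sum_const_zero] at hsum
  have hterm := (Finset.sum_eq_zero_iff_of_nonneg
    (fun l _ => mul_nonneg (hτ' l).le (sq_nonneg _))).1 hsum.symm j (Finset.mem_univ j)
  exact hfj (pow_eq_zero_iff two_ne_zero |>.1 ((mul_eq_zero.1 hterm).resolve_left (hτ' j).ne'))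

/-- the binary component decomposition of a matrix with Schur independent binary
components is unique up to permutation of the terms. -/
theorem bcd_uniqueness {n r r' : ℕ}
    (z : Fin r → Fin n → ℝ) (hz : ∀ i k, z i k = 0 ∨ z i k = 1)
    (hschur : BinarySchurIndependent z)
    (τ : Fin r → ℝ) (hτ : ∀ i, 0 < τ i) (hτsum : ∑ i, τ i = 1)
    (z' : Fin r' → Fin n → ℝ) (hz' : ∀ j k, z' j k = 0 ∨ z' j k = 1)
    (hdist : Function.Injective z')
    (τ' : Fin r' → ℝ) (hτ' : ∀ j, 0 < τ' j) (hτ'sum : ∑ j, τ' j = 1)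
    (heq : ∑ i, τ i • vecMulVec (z i) (z i) = ∑ j, τ' j • vecMulVec (z' j) (z' j)) :
    r' = r ∧ ∃ π : Fin r' ≃ Fin r, ∀ j, z' j = z (π j) ∧ τ' j = τ (π j) := by
  have hli := hschur.linearIndependent
  have hmatch : ∀ i, ∃ j, z' j = z i ∧ τ' j = τ i := by
    intro i
    obtain ⟨L, hL⟩ := LinearMap.exists_leftInverse_of_injective (Fintype.linearCombination ℝ z)
      (LinearMap.ker_eq_bot.2 hli.fintypeLinearCombination_injective)
    have hLz : ∀ k, L (z k) = Pi.single k 1 := fun k => by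
      simpa using LinearMap.congr_fun hL (Pi.single k 1)
    have hsum := sum_mul_sq_eq_of_sum_smul_vecMulVec_eq heq (LinearMap.proj i ∘ₗ L)
    have hcoord : ∀ j, (L (z' j) i) ^ 2 = if z' j = z i then 1 else 0 := fun j => by
      rcases hschur.eq_zero_or_exists_eq hz (hz' j)
        (mem_span_range_of_sum_smul_vecMulVec_eq hτ' heq j) with h0 | ⟨k, hk⟩
      · simp [h0, (hli.ne_zero i).symm]
      · rw [hk, hLz]
        simp [Pi.single_apply, hli.injective.eq_iff, eq_comm]
    simp only [LinearMap.comp_apply, LinearMap.proj_apply, hLz, hcoord, Pi.single_apply, ite_pow,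
      one_pow, ne_eq, OfNat.ofNat_ne_zero, not_false_eq_true, zero_pow, mul_ite, mul_one,
      mul_zero, Finset.sum_ite_eq, Finset.mem_univ, if_true] at hsum
    by_cases hex : ∃ j, z' j = z i
    · obtain ⟨j, hj⟩ := hex
      refine ⟨j, hj, ?_⟩
      simpa [← hj, hdist.eq_iff] using hsum.symm
    · push Not at hex
      simp only [hex, if_false, Finset.sum_const_zero] at hsum
      exact absurd hsum (hτ i).ne'
  choose g hgz hgτ using hmatch
  have hinj : Function.Injective g := fun i k hik => hli.injective (by rw [← hgz, hik, hgz])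
  have hsurj : Function.Surjective g := by
    intro j
    by_contra hj
    have hlt : ∑ l ∈ Finset.univ.image g, τ' l < ∑ l, τ' l :=
      Finset.sum_lt_sum_of_subset (Finset.subset_univ _) (Finset.mem_univ j)
        (by simpa using hj) (hτ' j) fun l _ _ => (hτ' l).le
    rw [Finset.sum_image hinj.injOn, hτ'sum] at hlt
    simp only [hgτ, hτsum, lt_irrefl] at hlt
  let π := (Equiv.ofBijective g ⟨hinj, hsurj⟩).symm
  have hgπ : ∀ j, g (π j) = j := (Equiv.ofBijective g ⟨hinj, hsurj⟩).apply_symm_apply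
  refine ⟨by simpa using Fintype.card_congr π, π, fun j => ⟨?_, ?_⟩⟩
  · rw [← hgz, hgπ]
  · rw [← hgτ, hgπ]
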